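/- arXiv:0805.4092 — 2 statements merged into one kernel-verified Lean document; each statement's English description precedes it below -/
import Mathlib

section
/- For every positive integer k, every δ > 0, and every R > 0, there exists N such that for all n ≥ N and every type p with denominator n on the alphabet X = {1,…,k} satisfying R < H(p), there exist M := ⌈e^{n(R−δ)}⌉ distinct sequences x_1,…,x_M in the type class T_p such that, for every index j and every conditional type V for x_j with output alphabet X, |T_V(x_j) ∩ ({x_1,…,x_M} \ {x_j})| ≤ |T_V(x_j)| · e^{−n(H(p)−R)}. -/
/-- The empirical distribution (type) of a word `x ∈ Xⁿ`. -/
noncomputable def typeOf {X : Type*} [Fintype X] [DecidableEq X] {n : ℕ}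
    (x : Fin n → X) : X → ℝ :=
  fun a => ((Finset.univ.filter fun j => x j = a).card : ℝ) / n

/-- The joint empirical distribution of the pair sequence `((x₁,y₁),…,(xₙ,yₙ))`. -/
noncomputable def jointType {X Y : Type*} [Fintype X] [DecidableEq X]
    [Fintype Y] [DecidableEq Y] {n : ℕ} (x : Fin n → X) (y : Fin n → Y) :
    X × Y → ℝ :=
  fun a => ((Finset.univ.filter fun j => x j = a.1 ∧ y j = a.2).card : ℝ) / n

/-- Shannon entropy `H(p) = -∑ p_i log p_i` (with `0 log 0 = 0`). -/
noncomputable def shannonH {X : Type*} [Fintype X] (p : X → ℝ) : ℝ :=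
  -∑ a, p a * Real.log (p a)

open Finset in
/-- Averaging over all `f : ι → T`, a row-summable kernel is small on a pair of distinct indices. -/
lemma sum_apply_pair_le {ι T : Type*} [Fintype ι] [DecidableEq ι] [Fintype T]
    (w : T → T → ℝ) (P : ℝ) (hP : ∀ x, ∑ y, w x y ≤ P) {i j : ι} (hij : i ≠ j) :
    Fintype.card T * ∑ f : ι → T, w (f i) (f j) ≤ Fintype.card (ι → T) * P := by
  have hsum : ∑ f : ι → T, w (f i) (f j)
      = ∑ g : {l // l ≠ j} → T, ∑ y, w (g ⟨i, hij⟩) y := by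
    rw [sum_comm, ← Fintype.sum_prod_type', ← (Equiv.funSplitAt j T).sum_comp]
    rfl
  have hcard : Fintype.card (ι → T)
      = Fintype.card T * Fintype.card ({l // l ≠ j} → T) := by
    rw [Fintype.card_congr (Equiv.funSplitAt j T), Fintype.card_prod]
  rw [hsum, hcard, Nat.cast_mul, mul_assoc]
  refine mul_le_mul_of_nonneg_left ?_ (Nat.cast_nonneg _)
  calc _ ≤ ∑ _g : {l // l ≠ j} → T, P := sum_le_sum fun g _ => hP _
    _ = _ := by simp

open Finset in
/-- Random coding: some family has small total off-diagonal weight. -/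
lemma exists_sum_offDiag_le {T : Type*} [Fintype T] [Nonempty T]
    (w : T → T → ℝ) (P : ℝ) (hP0 : 0 ≤ P) (hP : ∀ x, ∑ y, w x y ≤ P) (m : ℕ) :
    ∃ f : Fin m → T,
      Fintype.card T * ∑ i, ∑ j with j ≠ i, w (f i) (f j) ≤ m * m * P := by
  have h : ∑ f : Fin m → T, Fintype.card T * ∑ i, ∑ j with j ≠ i, w (f i) (f j)
      ≤ ∑ _f : Fin m → T, m * m * P := by
    calc _ = ∑ i : Fin m, ∑ j with j ≠ i,
          Fintype.card T * ∑ f : Fin m → T, w (f i) (f j) := by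
            rw [← mul_sum, sum_comm, mul_sum]
            refine sum_congr rfl fun i _ => ?_
            rw [sum_comm, mul_sum]
      _ ≤ ∑ i : Fin m, ∑ j : Fin m, Fintype.card (Fin m → T) * P := by
            refine sum_le_sum fun i _ => ?_
            refine (sum_le_sum fun j hj =>
              sum_apply_pair_le w P hP (mem_filter.1 hj).2.symm).trans ?_
            exact sum_le_sum_of_subset_of_nonneg (filter_subset _ _)
              fun _ _ _ => mul_nonneg (Nat.cast_nonneg _) hP0
      _ = _ := by
            simp only [sum_const, card_univ, nsmul_eq_mul, Fintype.card_fin]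
            ring
  obtain ⟨f, -, hf⟩ := exists_le_of_sum_le univ_nonempty h
  exact ⟨f, hf⟩

open Finset in
/-- Expurgation: half of a random family has small off-diagonal weight at every member. -/
lemma exists_forall_sum_offDiag_le {T : Type*} [Fintype T] [Nonempty T]
    (w : T → T → ℝ) (hw : ∀ x y, 0 ≤ w x y) (P B : ℝ) (hP0 : 0 ≤ P) (hB : 0 < B)
    (hP : ∀ x, ∑ y, w x y ≤ P) (M : ℕ) (hM : 4 * M * P ≤ B * Fintype.card T) :
    ∃ f : Fin M → T, ∀ i, ∑ j with j ≠ i, w (f i) (f j) ≤ B := by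
  obtain ⟨f, hf⟩ := exists_sum_offDiag_le w P hP0 hP (2 * M)
  set S : Fin (2 * M) → ℝ := fun i => ∑ j with j ≠ i, w (f i) (f j)
  have hS0 : ∀ i, 0 ≤ S i := fun i => sum_nonneg fun _ _ => hw _ _
  have hT : (0 : ℝ) < Fintype.card T := by exact_mod_cast Fintype.card_pos
  have hsum : ∑ i, S i ≤ M * B := by
    have h : (Fintype.card T : ℝ) * ∑ i, S i ≤ Fintype.card T * (M * B) := by
      refine hf.trans ?_
      push_cast
      nlinarith [mul_le_mul_of_nonneg_left hM (Nat.cast_nonneg (α := ℝ) M)]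
    exact le_of_mul_le_mul_left h hT
  have hbad : #{i | ¬ S i ≤ B} ≤ M := by
    have h : (#{i | ¬ S i ≤ B} : ℝ) * B ≤ M * B := by
      refine le_trans ?_ hsum
      rw [← nsmul_eq_mul]
      refine (card_nsmul_le_sum _ S B fun i hi => ?_).trans
        (sum_le_sum_of_subset_of_nonneg (filter_subset _ _) fun i _ _ => hS0 i)
      exact (not_le.1 (mem_filter.1 hi).2).le
    exact_mod_cast le_of_mul_le_mul_right h hB
  have hgood : M ≤ #{i | S i ≤ B} := by
    have := card_filter_add_card_filter_not (s := (univ : Finset (Fin (2 * M))))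
      (fun i => S i ≤ B)
    rw [card_univ, Fintype.card_fin] at this
    omega
  let e := (Fin.castLEEmb hgood).trans
    ({i | S i ≤ B} : Finset (Fin (2 * M))).equivFin.symm.toEmbedding
  refine ⟨fun i => f (e i), fun i => ?_⟩
  have hi : S (e i) ≤ B := (mem_filter.1 (e i).2).2
  refine le_trans ?_ hi
  let e' : Fin M ↪ Fin (2 * M) := e.trans (Function.Embedding.subtype _)
  calc ∑ j with j ≠ i, w (f (e i)) (f (e j))
      = ∑ j ∈ ({j | j ≠ i} : Finset (Fin M)).map e', w (f (e i)) (f j) := by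
        rw [sum_map]; rfl
    _ ≤ _ := by
        refine sum_le_sum_of_subset_of_nonneg (fun j hj => ?_) fun _ _ _ => hw _ _
        obtain ⟨l, hl, rfl⟩ := mem_map.1 hj
        exact mem_filter.2 ⟨mem_univ _, fun h => (mem_filter.1 hl).2 (e'.injective h)⟩

open Finset in
/-- The inverse fibre sizes of a map sum to the size of its image. -/
lemma sum_inv_card_fiber {α β : Type*} [Fintype α] [DecidableEq β] (g : α → β) :
    ∑ y, (#{z | g z = g y} : ℝ)⁻¹ = #(univ.image g) := by
  rw [← sum_fiberwise_of_maps_to (t := univ.image g) (g := g)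
    (fun y _ => mem_image_of_mem g (mem_univ y))]
  rw [card_eq_sum_ones, Nat.cast_sum]
  refine sum_congr rfl fun b hb => ?_
  obtain ⟨y, -, rfl⟩ := mem_image.1 hb
  have hne : (#{z | g z = g y} : ℝ) ≠ 0 := by
    have : 0 < #{z | g z = g y} := card_pos.2 ⟨y, by simp⟩
    positivity
  calc _ = ∑ z with g z = g y, (#{z | g z = g y} : ℝ)⁻¹ :=
        sum_congr rfl fun z hz => by rw [(mem_filter.1 hz).2]
    _ = _ := by simp [hne]

open Finset in
/-- There are at most `(n + 1) ^ (|X| |Y|)` joint types with a given word. -/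
lemma card_image_jointType_le {X Y : Type*} [Fintype X] [DecidableEq X] [Fintype Y]
    [DecidableEq Y] {n : ℕ} (x : Fin n → X) :
    #(univ.image (jointType (Y := Y) x)) ≤
      (n + 1) ^ (Fintype.card X * Fintype.card Y) := by
  have hle (y : Fin n → Y) (a : X × Y) : #{j | x j = a.1 ∧ y j = a.2} < n + 1 := by
    simpa [Nat.lt_succ_iff] using
      card_le_univ ({j | x j = a.1 ∧ y j = a.2} : Finset (Fin n))
  have hsub : univ.image (jointType (Y := Y) x) ⊆
      univ.image fun (c : X × Y → Fin (n + 1)) a => ((c a : ℕ) : ℝ) / n := by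
    intro q hq
    obtain ⟨y, -, rfl⟩ := mem_image.1 hq
    exact mem_image.2 ⟨fun a => ⟨_, hle y a⟩, mem_univ _, rfl⟩
  refine (card_le_card hsub).trans (card_image_le.trans ?_)
  simp

open Nat in
lemma factorial_mul_pow_le_factorial_mul_self_pow (a b : ℕ) :
    a ! * a ^ b ≤ b ! * a ^ a := by
  rcases le_total a b with h | h
  · calc a ! * a ^ b = (a ! * a ^ (b - a)) * a ^ a := by
          rw [mul_assoc, ← pow_add, Nat.sub_add_cancel h]
      _ ≤ _ := Nat.mul_le_mul_right _ (factorial_mul_pow_sub_le_factorial h)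
  · calc a ! * a ^ b = (a - (a - b))! * a.descFactorial (a - b) * a ^ b := by
          rw [factorial_mul_descFactorial (Nat.sub_le _ _)]
      _ ≤ b ! * a ^ (a - b) * a ^ b := by
          rw [Nat.sub_sub_self h]
          gcongr
          exact descFactorial_le_pow _ _
      _ = _ := by rw [mul_assoc, ← pow_add, Nat.sub_add_cancel h]

open Finset Nat in
/-- The multinomial distribution with weights `c` is maximal at `c`. -/
lemma multinomial_mul_prod_pow_le {X : Type*} [Fintype X] (c d : X → ℕ)
    (h : ∑ a, d a = ∑ a, c a) :
    multinomial univ d * ∏ a, c a ^ d a ≤ multinomial univ c * ∏ a, c a ^ c a := by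
  have hd := multinomial_spec univ d
  have hc := multinomial_spec univ c
  have key : (∏ a, (c a)!) * ∏ a, c a ^ d a ≤ (∏ a, (d a)!) * ∏ a, c a ^ c a := by
    rw [← prod_mul_distrib, ← prod_mul_distrib]
    exact prod_le_prod' fun a _ => factorial_mul_pow_le_factorial_mul_self_pow _ _
  have hpos : 0 < (∏ a, (c a)!) * ∏ a, (d a)! := by positivity
  refine le_of_mul_le_mul_left ?_ hpos
  calc _ = ((∏ a, (d a)!) * multinomial univ d) * ((∏ a, (c a)!) * ∏ a, c a ^ d a) := by ring
    _ ≤ ((∏ a, (d a)!) * multinomial univ d) * ((∏ a, (d a)!) * ∏ a, c a ^ c a) :=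
        Nat.mul_le_mul_left _ key
    _ = ((∏ a, (c a)!) * multinomial univ c) * ((∏ a, (d a)!) * ∏ a, c a ^ c a) := by
        rw [hd, hc, h]
    _ = _ := by ring

open Finset Nat in
lemma sum_pow_sum_le_multinomial {X : Type*} [Fintype X] [DecidableEq X] (c : X → ℕ) {n : ℕ}
    (h : ∑ a, c a = n) :
    n ^ n ≤ (n + 1) ^ Fintype.card X * (multinomial univ c * ∏ a, c a ^ c a) := by
  have hcard : #(piAntidiag (univ : Finset X) n) ≤ (n + 1) ^ Fintype.card X := by
    have hsub : piAntidiag (univ : Finset X) n ⊆ Fintype.piFinset fun _ => range (n + 1) := by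
      intro d hd
      rw [Fintype.mem_piFinset]
      intro a
      rw [mem_range, Nat.lt_succ_iff, ← (mem_piAntidiag.1 hd).1]
      exact single_le_sum (fun _ _ => Nat.zero_le _) (mem_univ a)
    simpa using card_le_card hsub
  calc n ^ n = (∑ a, c a) ^ n := by rw [h]
    _ = ∑ d ∈ piAntidiag univ n, multinomial univ d * ∏ a, c a ^ d a := by
        rw [sum_pow_eq_sum_piAntidiag]; simp
    _ ≤ ∑ _d ∈ piAntidiag (univ : Finset X) n, multinomial univ c * ∏ a, c a ^ c a :=
        sum_le_sum fun d hd =>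
          multinomial_mul_prod_pow_le c d ((mem_piAntidiag.1 hd).1.trans h.symm)
    _ ≤ _ := by
        rw [sum_const, smul_eq_mul]
        exact Nat.mul_le_mul_right _ hcard

open Finset in
lemma typeOf_comp_perm {X : Type*} [Fintype X] [DecidableEq X] {n : ℕ} (x : Fin n → X)
    (σ : Equiv.Perm (Fin n)) : typeOf (x ∘ σ) = typeOf x := by
  funext a
  unfold typeOf
  congr 2
  exact card_bij (fun j _ => σ j) (by simp) (by simp)
    fun j hj => ⟨σ.symm j, by simpa using hj, by simp⟩

open Finset Nat in
/-- A type class has at least as many members as the multinomial coefficient. -/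
lemma multinomial_le_card_typeClass {X : Type*} [Fintype X] [DecidableEq X] {n : ℕ}
    (x : Fin n → X) :
    multinomial univ (fun a => #{j | x j = a}) ≤ #{y : Fin n → X | typeOf y = typeOf x} := by
  have hstab : #{g : Equiv.Perm (Fin n) | x ∘ g = x} = ∏ a, (#{j | x j = a})! := by
    have := DomMulAct.stabilizer_card (f := x)
    simpa only [Fintype.card_subtype] using this
  have hle : #(univ : Finset (Equiv.Perm (Fin n))) ≤
      (∏ a, (#{j | x j = a})!) * #{y : Fin n → X | typeOf y = typeOf x} := by
    refine card_le_mul_card_image_of_maps_to (f := fun σ : Equiv.Perm (Fin n) => x ∘ σ)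
      (fun σ _ => by simpa using typeOf_comp_perm x σ) _ fun y _ => ?_
    rcases ({σ | x ∘ σ = y} : Finset (Equiv.Perm (Fin n))).eq_empty_or_nonempty with h | ⟨τ, hτ⟩
    · rw [h]; simp
    · rw [← hstab]
      refine card_le_card_of_injOn (fun σ => σ * τ⁻¹) (fun σ hσ => ?_)
        fun σ _ σ' _ h => mul_right_cancel h
      have h1 : x ∘ σ = y := by simpa using hσ
      have h2 : x ∘ τ = y := by simpa using hτ
      have h3 : x ∘ (σ * τ⁻¹ : Equiv.Perm (Fin n)) = x := by
        funext j
        have := congrFun (h1.trans h2.symm) (τ⁻¹ j)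
        simpa using this
      simpa using h3
  have hspec := multinomial_spec univ (fun a => #{j | x j = a})
  have hn : ∑ a, #{j | x j = a} = n := by
    have := card_eq_sum_card_fiberwise (f := x) (s := univ) (t := univ) (by simp)
    simpa using this.symm
  rw [hn] at hspec
  rw [Finset.card_univ, Fintype.card_perm, Fintype.card_fin, ← hspec] at hle
  exact le_of_mul_le_mul_left hle (by positivity)

open Finset in
/-- The method-of-types lower bound `e ^ (n H(p)) ≤ (n + 1) ^ |X| |T_p|`. -/
lemma exp_mul_shannonH_le {X : Type*} [Fintype X] [DecidableEq X] {n : ℕ} (hn0 : 0 < n)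
    (x : Fin n → X) :
    Real.exp (n * shannonH (typeOf x)) ≤
      (n + 1) ^ Fintype.card X * #{y : Fin n → X | typeOf y = typeOf x} := by
  set c : X → ℕ := fun a => #{j | x j = a}
  have hn : ∑ a, c a = n := by
    have := card_eq_sum_card_fiberwise (f := x) (s := univ) (t := univ) (by simp)
    simpa using this.symm
  have hnR : (0 : ℝ) < n := by exact_mod_cast hn0
  have hpos (a : X) : 0 < c a ^ c a := Nat.pow_self_pos
  have hterm (a : X) : Real.exp (n * (typeOf x a * Real.log (typeOf x a)))
      = (c a : ℝ) ^ c a / n ^ c a := by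
    rcases Nat.eq_zero_or_pos (c a) with h | h
    · have : typeOf x a = 0 := by
        change (c a : ℝ) / n = 0
        simp [h]
      simp [this, h]
    · have hT : typeOf x a = (c a : ℝ) / n := rfl
      have hcR : (0 : ℝ) < c a := by exact_mod_cast h
      rw [hT, ← mul_assoc, mul_div_cancel₀ _ hnR.ne', ← Real.log_pow,
        Real.exp_log (by positivity), div_pow]
  have hexp : Real.exp (n * shannonH (typeOf x)) = (n : ℝ) ^ n / ∏ a, (c a : ℝ) ^ c a := by
    rw [shannonH, mul_neg, Real.exp_neg, mul_sum, Real.exp_sum, prod_congr rfl fun a _ => hterm a,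
      prod_div_distrib, prod_pow_eq_pow_sum, hn, inv_div]
  have hprod : (0 : ℝ) < ∏ a, (c a : ℝ) ^ c a :=
    prod_pos fun a _ => by exact_mod_cast hpos a
  rw [hexp, div_le_iff₀ hprod]
  have h1 := sum_pow_sum_le_multinomial c hn
  have h2 := multinomial_le_card_typeClass x
  have h3 : n ^ n ≤ (n + 1) ^ Fintype.card X *
      #{y : Fin n → X | typeOf y = typeOf x} * ∏ a, c a ^ c a := by
    rw [mul_assoc]
    exact h1.trans (Nat.mul_le_mul_left _ (Nat.mul_le_mul_right _ h2))
  exact_mod_cast h3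

open Filter in
lemma eventually_mul_add_one_pow_le_exp (C δ : ℝ) (hδ : 0 < δ) (K : ℕ) :
    ∀ᶠ n : ℕ in atTop, C * ((n : ℝ) + 1) ^ K ≤ Real.exp (n * δ) := by
  have h := (isLittleO_pow_exp_pos_mul_atTop K hδ).comp_tendsto
    (tendsto_atTop_add_const_right atTop (1 : ℝ) (tendsto_natCast_atTop_atTop (R := ℝ)))
  have hε : 0 < ((|C| + 1) * Real.exp δ)⁻¹ := by positivity
  filter_upwards [h.bound hε] with n hn
  simp only [Function.comp_apply, Real.norm_eq_abs, Real.abs_exp] at hn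
  rw [abs_of_nonneg (by positivity), inv_mul_eq_div, le_div_iff₀ (by positivity), mul_add,
    mul_one, Real.exp_add, ← mul_assoc] at hn
  have h2 := le_of_mul_le_mul_right hn (Real.exp_pos δ)
  have hp : 0 ≤ ((n : ℝ) + 1) ^ K := by positivity
  rw [mul_comm δ] at h2
  nlinarith [mul_le_mul_of_nonneg_left (le_abs_self C) hp]

open Finset in
/-- A bound on the summed inverse shell sizes bounds the number of other codewords in
every shell. -/
lemma ncard_codewords_le_of_sum_le {α β : Type*} [Fintype α] [DecidableEq α] [DecidableEq β]
    {M : ℕ} (x : Fin M → α) (i : Fin M) (g : α → β) (y₀ : α) (B : ℝ)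
    (h : ∑ j with j ≠ i, (#{z | g z = g (x j)} : ℝ)⁻¹ ≤ B) :
    (Set.ncard {y | g y = g y₀ ∧ (∃ j, y = x j) ∧ y ≠ x i} : ℝ) ≤
      (Set.ncard {y | g y = g y₀} : ℝ) * B := by
  have hS : Set.ncard {y | g y = g y₀} = #{z | g z = g y₀} := by
    rw [← Set.ncard_coe_finset]; simp
  have hA : Set.ncard {y | g y = g y₀ ∧ (∃ j, y = x j) ∧ y ≠ x i} ≤
      #{j | j ≠ i ∧ g (x j) = g y₀} := by
    rw [← Set.ncard_coe_finset]
    refine (Set.ncard_le_ncard (t := x '' _) ?_ (Set.toFinite _)).trans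
      (Set.ncard_image_le (Set.toFinite _))
    rintro y ⟨h1, ⟨j, rfl⟩, h3⟩
    exact ⟨j, by simpa using ⟨fun hj => h3 (by rw [hj]), h1⟩, rfl⟩
  have hpos : (0 : ℝ) < #{z | g z = g y₀} := by
    exact_mod_cast card_pos.2 ⟨y₀, by simp⟩
  rw [hS]
  refine (Nat.cast_le.2 hA).trans ?_
  rw [mul_comm, ← div_le_iff₀ hpos]
  refine le_trans ?_ h
  calc (#{j | j ≠ i ∧ g (x j) = g y₀} : ℝ) / #{z | g z = g y₀}
      = ∑ j with j ≠ i ∧ g (x j) = g y₀, (#{z | g z = g (x j)} : ℝ)⁻¹ := by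
        rw [sum_congr rfl fun j hj => by rw [(mem_filter.1 hj).2.2], sum_const, nsmul_eq_mul,
          div_eq_mul_inv]
    _ ≤ _ := sum_le_sum_of_subset_of_nonneg
        (fun j hj => mem_filter.2 ⟨mem_univ _, (mem_filter.1 hj).2.1⟩)
        fun _ _ _ => by positivity

lemma eq_of_jointType_self_eq {X : Type*} [Fintype X] [DecidableEq X] {n : ℕ} (hn : 0 < n)
    {x y : Fin n → X} (h : jointType x y = jointType x x) : y = x := by
  funext j
  by_contra hne
  have h1 := congrFun h (x j, y j)
  have hnR : (n : ℝ) ≠ 0 := by exact_mod_cast hn.ne'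
  simp only [jointType, div_left_inj' hnR, Nat.cast_inj] at h1
  have h0 : (Finset.univ.filter fun l => x l = x j ∧ x l = y j) = ∅ :=
    Finset.filter_eq_empty_iff.2 fun l _ hl => hne (hl.2.symm.trans hl.1)
  rw [h0, Finset.card_empty, Finset.card_eq_zero, Finset.filter_eq_empty_iff] at h1
  exact h1 (Finset.mem_univ j) ⟨rfl, rfl⟩

/-- The packing lemma: for every `δ > 0` and `R > 0`, for all sufficiently large `n` and
every type `p` with denominator `n` satisfying `R < H(p)`, there are
`M = ⌈exp (n (R - δ))⌉` distinct sequences of type `p` such that for each codeword `x j`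
and each conditional type `V` for `x j` (represented by a sequence `y₀` realizing it),
`|T_V(x j) ∩ (codebook \ {x j})| ≤ |T_V(x j)| e^{-n(H(p)-R)}`. -/
theorem packing_lemma (k : ℕ) (hk : 0 < k) (δ R : ℝ) (hδ : 0 < δ) (hR : 0 < R) :
    ∃ N : ℕ, ∀ n, N ≤ n → ∀ p : Fin k → ℝ,
      (∃ x0 : Fin n → Fin k, typeOf x0 = p) →
      R < shannonH p →
      ∃ x : Fin (⌈Real.exp (n * (R - δ))⌉₊) → (Fin n → Fin k),
        Function.Injective x ∧ (∀ j, typeOf (x j) = p) ∧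
        ∀ j, ∀ y₀ : Fin n → Fin k,
          (Set.ncard {y : Fin n → Fin k |
              jointType (x j) y = jointType (x j) y₀ ∧ (∃ j', y = x j') ∧ y ≠ x j} : ℝ) ≤
            (Set.ncard {y : Fin n → Fin k |
              jointType (x j) y = jointType (x j) y₀} : ℝ) *
              Real.exp (-(n * (shannonH p - R))) := by
  classical
  obtain ⟨N, hN⟩ := Filter.eventually_atTop.1
    (eventually_mul_add_one_pow_le_exp 8 δ hδ (k * k + k))
  refine ⟨N + 1, fun n hn p ⟨x0, hx0⟩ hRH => ?_⟩
  have hn0 : 0 < n := by omega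
  have hnR : (0 : ℝ) < n := by exact_mod_cast hn0
  set M := ⌈Real.exp (n * (R - δ))⌉₊ with hMdef
  set B := Real.exp (-(n * (shannonH p - R))) with hBdef
  have hB1 : B < 1 := Real.exp_lt_one_iff.2 (neg_lt_zero.2 (mul_pos hnR (sub_pos.2 hRH)))
  rcases le_total R δ with hRδ | hRδ
  · have hM : M = 1 := by
      rw [hMdef, Nat.ceil_eq_iff one_ne_zero]
      refine ⟨by simpa using Real.exp_pos _, ?_⟩
      rw [Nat.cast_one, Real.exp_le_one_iff]
      exact mul_nonpos_of_nonneg_of_nonpos hnR.le (by linarith)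
    have hsub : Subsingleton (Fin M) := by rw [hM]; infer_instance
    refine ⟨fun _ => x0, fun i j _ => Subsingleton.elim i j, fun _ => hx0, fun j y₀ => ?_⟩
    have hempty : {y : Fin n → Fin k | jointType x0 y = jointType x0 y₀ ∧
        (∃ _j' : Fin M, y = x0) ∧ y ≠ x0} = ∅ := by
      ext y
      simp
    rw [hempty, Set.ncard_empty, Nat.cast_zero]
    positivity
  · let T := {y : Fin n → Fin k // typeOf y = p}
    have : Nonempty T := ⟨⟨x0, hx0⟩⟩
    let w : T → T → ℝ := fun x y =>
      ((Finset.univ.filter fun z => jointType x.1 z = jointType x.1 y.1).card : ℝ)⁻¹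
    have hP (x : T) : ∑ y, w x y ≤ ((n : ℝ) + 1) ^ (k * k) := by
      have h1 : ∑ y, w x y ≤ ∑ y : Fin n → Fin k,
          ((Finset.univ.filter fun z => jointType x.1 z = jointType x.1 y).card : ℝ)⁻¹ := by
        refine le_of_eq_of_le (Finset.sum_map Finset.univ (Function.Embedding.subtype _) fun y =>
          ((Finset.univ.filter fun z => jointType x.1 z = jointType x.1 y).card : ℝ)⁻¹).symm ?_
        exact Finset.sum_le_sum_of_subset_of_nonneg (Finset.subset_univ _)
          fun _ _ _ => by positivity
      refine h1.trans ?_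
      rw [sum_inv_card_fiber (jointType x.1)]
      have := card_image_jointType_le (Y := Fin k) x.1
      simp only [Fintype.card_fin] at this
      exact_mod_cast this
    have hTcard : Real.exp (n * shannonH p) ≤ ((n : ℝ) + 1) ^ k * Fintype.card T := by
      have := exp_mul_shannonH_le hn0 x0
      rw [hx0, Fintype.card_fin] at this
      rwa [Fintype.card_subtype]
    have hM2 : (M : ℝ) ≤ 2 * Real.exp (n * (R - δ)) := by
      have h1 : 1 ≤ Real.exp (n * (R - δ)) :=
        Real.one_le_exp (mul_nonneg hnR.le (by linarith))
      have h2 := Nat.ceil_lt_add_one (Real.exp_pos (n * (R - δ))).le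
      linarith
    have hcount : 4 * M * ((n : ℝ) + 1) ^ (k * k) ≤ B * Fintype.card T := by
      have hpow : (0 : ℝ) < ((n : ℝ) + 1) ^ k := by positivity
      refine le_of_mul_le_mul_right ?_ hpow
      calc 4 * M * ((n : ℝ) + 1) ^ (k * k) * ((n : ℝ) + 1) ^ k
          ≤ 4 * (2 * Real.exp (n * (R - δ))) * ((n : ℝ) + 1) ^ (k * k) * ((n : ℝ) + 1) ^ k := by
            gcongr
        _ = Real.exp (n * (R - δ)) * (8 * ((n : ℝ) + 1) ^ (k * k + k)) := by
            rw [pow_add]; ring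
        _ ≤ Real.exp (n * (R - δ)) * Real.exp (n * δ) :=
            mul_le_mul_of_nonneg_left (hN n (by omega)) (Real.exp_pos _).le
        _ = B * Real.exp (n * shannonH p) := by
            rw [hBdef, ← Real.exp_add, ← Real.exp_add]
            congr 1
            ring
        _ ≤ B * (((n : ℝ) + 1) ^ k * Fintype.card T) :=
            mul_le_mul_of_nonneg_left hTcard (Real.exp_pos _).le
        _ = _ := by ring
    obtain ⟨f, hf⟩ := exists_forall_sum_offDiag_le w (fun x y => by positivity)
      (((n : ℝ) + 1) ^ (k * k)) B (by positivity) (Real.exp_pos _) hP M hcount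
    refine ⟨fun i => (f i).1, fun i j hij => ?_, fun j => (f j).2, fun j y₀ =>
      ncard_codewords_le_of_sum_le (fun i => (f i).1) j (jointType (f j).1) y₀ B (hf j)⟩
    by_contra hne
    have hw : w (f i) (f j) = 1 := by
      have hfil : (Finset.univ.filter fun z => jointType (f i).1 z = jointType (f i).1 (f j).1)
          = {(f i).1} := by
        ext z
        rw [Finset.mem_filter, Finset.mem_singleton, ← show (f i).1 = (f j).1 from hij]
        exact ⟨fun h => eq_of_jointType_self_eq hn0 h.2, fun h => by simp [h]⟩
      simp only [w, hfil, Finset.card_singleton, Nat.cast_one, inv_one]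
    have h1 : w (f i) (f j) ≤ ∑ l with l ≠ i, w (f i) (f l) :=
      Finset.single_le_sum (f := fun l => w (f i) (f l)) (fun _ _ => by positivity)
        (Finset.mem_filter.2 ⟨Finset.mem_univ j, fun h => hne h.symm⟩)
    linarith [hf i]
end

section
/- Let W be a classical-quantum channel with input alphabet X = {1,…,k} and output dimension d such that each W(i) is positive definite, and let p be a probability vector on X. Then the function t ↦ φ_{W,p}(t) is differentiable at t = 0, and its derivative there equals the quantum mutual information I(p,W) := ∑_{i=1}^k p_i Tr[W(i)(log W(i) − log W_p)], where W_p := ∑_{i=1}^k p_i W(i). -/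
open Matrix
open scoped ComplexOrder

open Classical in
/-- The power `A^s` of a positive semidefinite (more generally Hermitian) matrix,
obtained by applying `x ↦ x ^ s` to the eigenvalues in a spectral decomposition. -/
noncomputable def matRpow {ι : Type*} [Fintype ι] [DecidableEq ι]
    (A : Matrix ι ι ℂ) (s : ℝ) : Matrix ι ι ℂ :=
  if hA : A.IsHermitian then
    (hA.eigenvectorUnitary : Matrix ι ι ℂ) *
      Matrix.diagonal (fun i => ((hA.eigenvalues i ^ s : ℝ) : ℂ)) *
      star (hA.eigenvectorUnitary : Matrix ι ι ℂ)
  else 0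

open Classical in
/-- The matrix logarithm of a positive definite (more generally Hermitian) matrix, via
the spectral decomposition. -/
noncomputable def matLog {ι : Type*} [Fintype ι] [DecidableEq ι]
    (A : Matrix ι ι ℂ) : Matrix ι ι ℂ :=
  if hA : A.IsHermitian then
    (hA.eigenvectorUnitary : Matrix ι ι ℂ) *
      Matrix.diagonal (fun i => ((Real.log (hA.eigenvalues i) : ℝ) : ℂ)) *
      star (hA.eigenvectorUnitary : Matrix ι ι ℂ)
  else 0

/-- `φ_{W,p}(t) = -(1-t) log Tr[(∑ᵢ pᵢ W(i)^{1-t})^{1/(1-t)}]`. -/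
noncomputable def phiW {k d : ℕ} (W : Fin k → Matrix (Fin d) (Fin d) ℂ)
    (p : Fin k → ℝ) (t : ℝ) : ℝ :=
  -(1 - t) * Real.log
    ((matRpow (∑ i, (p i : ℂ) • matRpow (W i) (1 - t)) (1 / (1 - t))).trace.re)

open Topology Filter in
/-- Joint continuity of the continuous functional calculus in a parametrized function and a
parametrized self-adjoint element. -/
lemma continuousAt_cfc_of_continuousOn_prod {A : Type*} [CStarAlgebra A] {Q : ℝ → ℝ → ℝ}
    {S : ℝ → A} {t₀ : ℝ} {U V : Set ℝ} (hU : U ∈ 𝓝 t₀) (hV : IsOpen V)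
    (hQ : ContinuousOn (Function.uncurry Q) (U ×ˢ V)) (hS : ContinuousAt S t₀)
    (hSA : ∀ t, IsSelfAdjoint (S t)) (hspec : spectrum ℝ (S t₀) ⊆ V) :
    ContinuousAt (fun t => cfc (Q t) (S t)) t₀ := by
  obtain ⟨C, hC, hCU, hCc⟩ := local_compact_nhds hU
  have hcont : ∀ t ∈ U, ContinuousOn (Q t) V := fun t ht =>
    hQ.comp (f := fun x => (t, x)) (by fun_prop) fun x hx => ⟨ht, hx⟩
  have hspec_ev : ∀ᶠ t in 𝓝 t₀, spectrum ℝ (S t) ⊆ V :=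
    hS.eventually (upperHemicontinuous_iff_forall_isOpen.mp
      (upperHemicontinuous_spectrum ℝ A) (S t₀) V hV hspec)
  have key := (continuousOn_cfc_setProd_nhdsSet (𝕜 := ℝ) (A := A) (p := IsSelfAdjoint) (s := V))
    (UniformOnFun.ofFun _ (Q t₀), S t₀)
    ⟨hcont t₀ (mem_of_mem_nhds hU), hSA t₀, hV.mem_nhdsSet.mpr hspec⟩
  have hfun : Tendsto (fun t => UniformOnFun.ofFun {K : Set ℝ | IsCompact K ∧ K ⊆ V} (Q t))
      (𝓝 t₀) (𝓝 (UniformOnFun.ofFun _ (Q t₀))) := by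
    rw [UniformOnFun.tendsto_iff_tendstoUniformlyOn]
    rintro K ⟨hK, hKV⟩
    have huc := (hCc.prod hK).uniformContinuousOn_of_continuous
      (hQ.mono (Set.prod_mono hCU hKV))
    have := huc.tendstoUniformlyOn (F := Q) (mem_of_mem_nhds hC)
    rwa [nhdsWithin_eq_nhds.mpr hC] at this
  refine Tendsto.comp key (tendsto_nhdsWithin_iff.mpr ⟨hfun.prodMk_nhds hS, ?_⟩)
  filter_upwards [hspec_ev, hU] with t ht htU
  exact ⟨hcont t htU, hSA t, hV.mem_nhdsSet.mpr ht⟩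

section MatrixPowers

variable {ι : Type*} [Fintype ι] [DecidableEq ι] {A : Matrix ι ι ℂ}

lemma matRpow_eq_cfc (A : Matrix ι ι ℂ) (s : ℝ) : matRpow A s = cfc (fun x : ℝ => x ^ s) A := by
  by_cases hA : A.IsHermitian
  · rw [hA.cfc_eq, matRpow, dif_pos hA, Matrix.IsHermitian.cfc,
      Unitary.conjStarAlgAut_apply]
    rfl
  · rw [matRpow, dif_neg hA, cfc_apply_of_not_predicate (p := IsSelfAdjoint) A hA]

lemma matLog_eq_cfc (A : Matrix ι ι ℂ) : matLog A = cfc Real.log A := by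
  by_cases hA : A.IsHermitian
  · rw [hA.cfc_eq, matLog, dif_pos hA, Matrix.IsHermitian.cfc,
      Unitary.conjStarAlgAut_apply]
    rfl
  · rw [matLog, dif_neg hA, cfc_apply_of_not_predicate (p := IsSelfAdjoint) A hA]

lemma Matrix.IsHermitian.trace_cfc (hA : A.IsHermitian) (f : ℝ → ℝ) :
    (cfc f A).trace = ∑ i, (f (hA.eigenvalues i) : ℂ) := by
  rw [hA.cfc_eq, Matrix.IsHermitian.cfc, Unitary.conjStarAlgAut_apply, Matrix.trace_mul_cycle,
    Unitary.coe_star_mul_self, one_mul, Matrix.trace_diagonal]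
  rfl

lemma Matrix.continuousOn_spectrum (A : Matrix ι ι ℂ) (f : ℝ → ℝ) :
    ContinuousOn f (spectrum ℝ A) :=
  A.finite_real_spectrum.continuousOn f

lemma mul_matLog_eq_cfc (hA : A.IsHermitian) :
    A * matLog A = cfc (fun x : ℝ => x * Real.log x) A := by
  rw [matLog_eq_cfc, cfc_mul (fun x : ℝ => x) Real.log A (A.continuousOn_spectrum _)
    (A.continuousOn_spectrum _), cfc_id' ℝ A hA.isSelfAdjoint]

lemma isHermitian_matRpow (A : Matrix ι ι ℂ) (s : ℝ) : (matRpow A s).IsHermitian := by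
  rw [matRpow_eq_cfc]
  exact cfc_predicate _ A

lemma matRpow_one (hA : A.IsHermitian) : matRpow A 1 = A := by
  rw [matRpow_eq_cfc]
  simpa using cfc_id' ℝ A hA.isSelfAdjoint

lemma Matrix.PosDef.spectrum_subset_Ioi (hA : A.PosDef) : spectrum ℝ A ⊆ Set.Ioi 0 := by
  rw [hA.1.spectrum_real_eq_range_eigenvalues]
  rintro _ ⟨i, rfl⟩
  exact hA.eigenvalues_pos i

lemma continuous_matRpow (hA : A.PosDef) : Continuous fun s => matRpow A s := by
  simp only [matRpow, dif_pos hA.1]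
  refine (continuous_const.matrix_mul (Continuous.matrix_diagonal ?_)).matrix_mul continuous_const
  exact continuous_pi fun i => Complex.continuous_ofReal.comp
    (Real.continuous_const_rpow (hA.eigenvalues_pos i).ne')

lemma hasDerivAt_trace_matRpow (hA : A.PosDef) :
    HasDerivAt (fun t : ℝ => (matRpow A (1 - t)).trace.re)
      (-(A * matLog A).trace.re) 0 := by
  rw [mul_matLog_eq_cfc hA.1]
  simp only [matRpow_eq_cfc, hA.1.trace_cfc, ← Complex.ofReal_sum, Complex.ofReal_re]
  rw [← Finset.sum_neg_distrib]
  refine HasDerivAt.fun_sum fun i _ => ?_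
  have h := ((hasDerivAt_id (0 : ℝ)).const_sub 1).const_rpow (hA.eigenvalues_pos i)
  convert! h using 1
  simp
  ring

end MatrixPowers

/-- The difference quotient `(x ^ (1 / (1 - t)) - x) / t`, extended continuously to `t = 0`. -/
noncomputable def rpowSlope (t x : ℝ) : ℝ :=
  x * (dslope Real.exp 0 (t / (1 - t) * Real.log x) * (Real.log x / (1 - t)))

lemma rpowSlope_zero (x : ℝ) : rpowSlope 0 x = x * Real.log x := by
  simp [rpowSlope]

lemma rpow_eq_add_mul_rpowSlope {t x : ℝ} (ht : t < 1) (hx : 0 < x) :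
    x ^ (1 / (1 - t)) = x + t * rpowSlope t x := by
  have h1 : 1 - t ≠ 0 := by linarith
  have h := sub_smul_dslope Real.exp 0 (t / (1 - t) * Real.log x)
  rw [Real.exp_zero, sub_zero, smul_eq_mul] at h
  have hexp : x ^ (1 / (1 - t)) = x * Real.exp (t / (1 - t) * Real.log x) := by
    rw [show 1 / (1 - t) = 1 + t / (1 - t) by field_simp; ring, Real.rpow_add hx, Real.rpow_one,
      Real.rpow_def_of_pos hx, mul_comm (Real.log x)]
  rw [hexp, eq_add_of_sub_eq h.symm, rpowSlope]
  ring

lemma continuousOn_rpowSlope :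
    ContinuousOn (Function.uncurry rpowSlope) (Set.Iio 1 ×ˢ Set.Ioi 0) := by
  have hd : Continuous (dslope Real.exp 0) := by
    rw [← continuousOn_univ, continuousOn_dslope Filter.univ_mem]
    exact ⟨Real.continuous_exp.continuousOn, Real.differentiableAt_exp⟩
  have hlog : ContinuousOn (fun y : ℝ × ℝ => Real.log y.2) (Set.Iio 1 ×ˢ Set.Ioi 0) :=
    ContinuousOn.log (by fun_prop) fun y hy => (Set.mem_Ioi.mp hy.2).ne'
  have h1 : ∀ y ∈ (Set.Iio 1 ×ˢ Set.Ioi 0 : Set (ℝ × ℝ)), 1 - y.1 ≠ 0 :=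
    fun y hy => (sub_pos.mpr hy.1).ne'
  refine continuousOn_snd.mul ((hd.comp_continuousOn ?_).mul (hlog.div (by fun_prop) h1))
  exact (ContinuousOn.div (by fun_prop) (by fun_prop) h1).mul hlog

open Topology Filter Matrix.Norms.L2Operator in
/-- First-order expansion of the trace of a power with varying base and exponent. -/
lemma hasDerivAt_trace_matRpow_inv {ι : Type*} [Fintype ι] [DecidableEq ι]
    {S : ℝ → Matrix ι ι ℂ} {s' : ℝ} (hS : ContinuousAt S 0) (hSH : ∀ t, (S t).IsHermitian)
    (hS0 : (S 0).PosDef) (hS' : HasDerivAt (fun t => (S t).trace.re) s' 0) :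
    HasDerivAt (fun t => (matRpow (S t) (1 / (1 - t))).trace.re)
      (s' + (S 0 * matLog (S 0)).trace.re) 0 := by
  have hcont : ContinuousAt (fun t => cfc (rpowSlope t) (S t)) 0 :=
    continuousAt_cfc_of_continuousOn_prod (Iio_mem_nhds one_pos) isOpen_Ioi
      continuousOn_rpowSlope hS hSH hS0.spectrum_subset_Ioi
  have htr : ContinuousAt (fun t => (cfc (rpowSlope t) (S t)).trace.re) 0 :=
    (Complex.continuous_re.comp (continuous_id.matrix_trace)).continuousAt.comp hcont
  have hslope : HasDerivAt (fun t => t * (cfc (rpowSlope t) (S t)).trace.re)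
      (S 0 * matLog (S 0)).trace.re 0 := by
    rw [hasDerivAt_iff_tendsto_slope]
    have h0 : (cfc (rpowSlope 0) (S 0)).trace.re = (S 0 * matLog (S 0)).trace.re := by
      rw [mul_matLog_eq_cfc (hSH 0), funext rpowSlope_zero]
    rw [← h0]
    refine (htr.tendsto.mono_left nhdsWithin_le_nhds).congr' ?_
    filter_upwards [self_mem_nhdsWithin] with t ht
    have ht' : t ≠ 0 := ht
    simp [slope_def_field, ht']
  have hspec : ∀ᶠ t in 𝓝 (0 : ℝ), spectrum ℝ (S t) ⊆ Set.Ioi 0 :=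
    hS.eventually (upperHemicontinuous_iff_forall_isOpen.mp
      (upperHemicontinuous_spectrum ℝ (Matrix ι ι ℂ)) (S 0) _ isOpen_Ioi
      hS0.spectrum_subset_Ioi)
  refine (hS'.add hslope).congr_of_eventuallyEq ?_
  filter_upwards [hspec, Iio_mem_nhds one_pos] with t ht ht1
  have hpow : matRpow (S t) (1 / (1 - t)) = cfc (fun x => x + t * rpowSlope t x) (S t) := by
    rw [matRpow_eq_cfc]
    exact cfc_congr fun x hx => rpow_eq_add_mul_rpowSlope ht1 (ht hx)
  rw [hpow]
  have hid : (S t).trace = ∑ i, ((hSH t).eigenvalues i : ℂ) := (hSH t).trace_eq_sum_eigenvalues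
  simp only [Pi.add_apply, hid, (hSH t).trace_cfc, ← Complex.ofReal_sum, Complex.ofReal_re,
    Finset.sum_add_distrib, Finset.mul_sum]

lemma posDef_sum_smul {k d : ℕ} {W : Fin k → Matrix (Fin d) (Fin d) ℂ} (hW : ∀ i, (W i).PosDef)
    {p : Fin k → ℝ} (hp : ∀ i, 0 ≤ p i) (hp1 : ∑ i, p i = 1) :
    (∑ i, (p i : ℂ) • W i).PosDef := by
  obtain ⟨j, -, hj⟩ : ∃ j ∈ Finset.univ, p j ≠ 0 :=
    Finset.exists_ne_zero_of_sum_ne_zero (by rw [hp1]; exact one_ne_zero)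
  rw [← Finset.add_sum_erase _ _ (Finset.mem_univ j)]
  refine Matrix.PosDef.add_posSemidef ?_ (Matrix.posSemidef_sum _ fun i _ => ?_)
  · exact (hW j).smul (by exact_mod_cast (hp j).lt_of_ne' hj)
  · exact (hW i).posSemidef.smul (by exact_mod_cast hp i)

/-- For a classical-quantum channel with positive definite output states, `t ↦ φ_{W,p}(t)`
is differentiable at `t = 0` with derivative the quantum mutual information
`I(p,W) = ∑ᵢ pᵢ Tr[W(i)(log W(i) - log W_p)]`. -/
theorem phi_hasDerivAt_zero (k d : ℕ) (W : Fin k → Matrix (Fin d) (Fin d) ℂ)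
    (hW : ∀ i, (W i).PosDef ∧ (W i).trace = 1)
    (p : Fin k → ℝ) (hp : ∀ i, 0 ≤ p i) (hp1 : ∑ i, p i = 1) :
    HasDerivAt (fun t => phiW W p t)
      (∑ i, p i *
        ((W i * (matLog (W i) - matLog (∑ j, (p j : ℂ) • W j))).trace).re) 0 := by
  have hsum_re (M : Fin k → Matrix (Fin d) (Fin d) ℂ) :
      (∑ i, (p i : ℂ) • M i).trace.re = ∑ i, p i * (M i).trace.re := by
    simp [Matrix.trace_sum]
  set S : ℝ → Matrix (Fin d) (Fin d) ℂ := fun t => ∑ i, (p i : ℂ) • matRpow (W i) (1 - t) with hS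
  have hS0 : S 0 = ∑ i, (p i : ℂ) • W i := by
    simp only [hS, sub_zero, matRpow_one (hW _).1.1]
  have hcont : Continuous S := continuous_finsetSum _ fun i _ =>
    Continuous.const_smul ((continuous_matRpow (hW i).1).comp
      (continuous_const.sub continuous_id : Continuous fun t : ℝ => 1 - t)) (p i : ℂ)
  have hSH : ∀ t, (S t).IsHermitian := fun t => isSelfAdjoint_sum _ fun i _ =>
    IsSelfAdjoint.smul (Complex.conj_ofReal (p i)) (isHermitian_matRpow (W i) (1 - t)).isSelfAdjoint
  have hS' : HasDerivAt (fun t => (S t).trace.re)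
      (∑ i, p i * -(W i * matLog (W i)).trace.re) 0 := by
    simp only [hS, hsum_re]
    exact HasDerivAt.fun_sum fun i _ => (hasDerivAt_trace_matRpow (hW i).1).const_mul (p i)
  have hpos : (S 0).PosDef := hS0 ▸ posDef_sum_smul (fun i => (hW i).1) hp hp1
  have hg := hasDerivAt_trace_matRpow_inv hcont.continuousAt hSH hpos hS'
  have hg0 : (matRpow (S 0) (1 / (1 - 0))).trace.re = 1 := by
    rw [sub_zero, div_one, matRpow_one (hSH 0), hS0, hsum_re]
    simp [(hW _).2, hp1]
  have hphi := ((hasDerivAt_id (0 : ℝ)).const_sub 1).neg.mul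
    (hg.log (by rw [hg0]; exact one_ne_zero))
  convert! hphi using 1
  have hcross : (S 0 * matLog (S 0)).trace.re =
      ∑ i, p i * (W i * matLog (S 0)).trace.re := by
    rw [← hsum_re fun i => W i * matLog (S 0)]
    congr 2
    conv_lhs => rw [hS0, Finset.sum_mul]
    simp only [hS0, Matrix.smul_mul]
  rw [hg0, hcross, ← hS0]
  simp [mul_sub, Finset.sum_sub_distrib]
  ring
end
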